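/- Conditional expectation for the Gaussian midpoint: let X₀ and X₁ be independent real-valued random variables on a probability space with laws N(μ₀, σ²) and N(μ₁, σ²) respectively, where σ² > 0, and let Z = (X₀ + X₁)/2. Then the conditional expectation of X₀ given the σ-algebra generated by Z satisfies, almost surely, E[ X₀ | σ(Z) ] = Z + (μ₀ − μ₁)/2. -/

import Mathlib

open MeasureTheory ProbabilityTheory
open scoped NNReal

/-- The sum and the difference of two independent real Gaussian random variables with the same
variance are independent. -/
lemma indepFun_add_sub_of_variance_eq {Ω : Type*} {mΩ : MeasurableSpace Ω} {P : Measure Ω}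
    {X Y : Ω → ℝ} (hX : HasGaussianLaw X P) (hY : HasGaussianLaw Y P) (hXY : IndepFun X Y P)
    (hvar : Var[X; P] = Var[Y; P]) :
    IndepFun (X + Y) (X - Y) P := by
  have := hX.isProbabilityMeasure
  have hX2 := hX.memLp_two
  have hY2 := hY.memLp_two
  let L : ℝ × ℝ →L[ℝ] ℝ × ℝ :=
    (ContinuousLinearMap.fst ℝ ℝ ℝ + ContinuousLinearMap.snd ℝ ℝ ℝ).prod
      (ContinuousLinearMap.fst ℝ ℝ ℝ - ContinuousLinearMap.snd ℝ ℝ ℝ)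
  refine HasGaussianLaw.indepFun_of_covariance_eq_zero ((hXY.hasGaussianLaw hX hY).map L) ?_
  rw [covariance_add_left hX2 hY2 (hX2.sub hY2), covariance_sub_right hX2 hX2 hY2,
    covariance_sub_right hY2 hX2 hY2, covariance_self hX.aemeasurable,
    covariance_self hY.aemeasurable, covariance_comm Y X, hvar]
  ring

/-- Conditional expectation for the Gaussian midpoint: if `X₀ ~ N(μ₀, σ²)` and
`X₁ ~ N(μ₁, σ²)` are independent and `Z = (X₀ + X₁)/2`, then almost surely
`E[X₀ | σ(Z)] = Z + (μ₀ − μ₁)/2`. -/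
theorem gaussian_midpoint_condexp {Ω : Type*} [MeasurableSpace Ω]
    (P : Measure Ω) [IsProbabilityMeasure P]
    (X₀ X₁ : Ω → ℝ) (hX₀ : Measurable X₀) (hX₁ : Measurable X₁)
    (hindep : IndepFun X₀ X₁ P)
    (μ₀ μ₁ : ℝ) (v : ℝ≥0) (hv : 0 < v)
    (h₀ : P.map X₀ = gaussianReal μ₀ v) (h₁ : P.map X₁ = gaussianReal μ₁ v) :
    P[X₀ | MeasurableSpace.comap (fun ω => (X₀ ω + X₁ ω) / 2) inferInstance]
      =ᵐ[P] fun ω => (X₀ ω + X₁ ω) / 2 + (μ₀ - μ₁) / 2 := by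
  have law₀ : HasLaw X₀ (gaussianReal μ₀ v) P := ⟨hX₀.aemeasurable, h₀⟩
  have law₁ : HasLaw X₁ (gaussianReal μ₁ v) P := ⟨hX₁.aemeasurable, h₁⟩
  have int₀ : Integrable X₀ P := law₀.hasGaussianLaw.integrable
  have int₁ : Integrable X₁ P := law₁.hasGaussianLaw.integrable
  set Z : Ω → ℝ := fun ω => (X₀ ω + X₁ ω) / 2 with hZ
  set W : Ω → ℝ := fun ω => (X₀ ω - X₁ ω) / 2 with hW
  have hZm : Measurable Z := by fun_prop
  have hWm : Measurable W := by fun_prop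
  have intZ : Integrable Z P := (int₀.add int₁).div_const 2
  have intW : Integrable W P := (int₀.sub int₁).div_const 2
  have hZW : IndepFun Z W P :=
    (indepFun_add_sub_of_variance_eq law₀.hasGaussianLaw law₁.hasGaussianLaw hindep
      (by rw [law₀.variance_eq, law₁.variance_eq, variance_id_gaussianReal,
        variance_id_gaussianReal])).comp
      (φ := (· / 2)) (ψ := (· / 2)) (by fun_prop) (by fun_prop)
  have mean_W : ∫ ω, W ω ∂P = (μ₀ - μ₁) / 2 := by
    rw [integral_div, integral_sub int₀ int₁, law₀.integral_eq, law₁.integral_eq,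
      integral_id_gaussianReal, integral_id_gaussianReal]
  have hX₀_eq : X₀ = Z + W := by
    ext ω
    simp only [hZ, hW, Pi.add_apply]
    ring
  have condExp_Z : P[Z | MeasurableSpace.comap Z inferInstance] = Z :=
    condExp_of_stronglyMeasurable hZm.comap_le
      (comap_measurable Z).stronglyMeasurable intZ
  have condExp_W : P[W | MeasurableSpace.comap Z inferInstance] =ᵐ[P] fun _ => ∫ ω, W ω ∂P :=
    condExp_indep_eq hWm.comap_le hZm.comap_le
      (comap_measurable W).stronglyMeasurable hZW.symm
  nth_rw 1 [hX₀_eq]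
  filter_upwards [condExp_add intZ intW (MeasurableSpace.comap Z inferInstance), condExp_W]
    with ω h_add h_W
  rw [h_add, Pi.add_apply, condExp_Z, h_W, mean_W]
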